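/- arXiv:2409.19198 — 11 statements merged into one kernel-verified Lean document; each statement's English description precedes it below -/
import Mathlib

section
/- Let M and N be Puiseux monoids such that N is finitely generated. If M is atomic, then the internal sum M + N is atomic. -/
namespace PuiseuxSum

/-- `a` is an atom of the Puiseux monoid `M`: it is a nonzero element of `M`
that cannot be written as a sum of two nonzero elements of `M`. -/
def IsAtom (M : AddSubmonoid ℚ) (a : ℚ) : Prop :=
  a ∈ M ∧ a ≠ 0 ∧ ∀ b ∈ M, ∀ c ∈ M, a = b + c → b = 0 ∨ c = 0

/-- The Puiseux monoid `M` is atomic if every element of `M` belongs to the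
additive submonoid generated by the atoms of `M`. -/
def Atomic (M : AddSubmonoid ℚ) : Prop :=
  ∀ x ∈ M, x ∈ AddSubmonoid.closure {a : ℚ | IsAtom M a}

theorem closure_isAtom_le (M : AddSubmonoid ℚ) :
    AddSubmonoid.closure {a : ℚ | IsAtom M a} ≤ M :=
  (AddSubmonoid.closure_le).2 fun _ ha => ha.1

theorem mem_sup_closure_singleton {M : AddSubmonoid ℚ} {r x : ℚ} :
    x ∈ M ⊔ AddSubmonoid.closure {r} ↔ ∃ m ∈ M, ∃ k : ℕ, m + k * r = x := by
  simp only [AddSubmonoid.mem_sup, AddSubmonoid.mem_closure_singleton]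
  constructor
  · rintro ⟨m, hm, _, ⟨k, rfl⟩, rfl⟩
    exact ⟨m, hm, k, by rw [nsmul_eq_mul]⟩
  · rintro ⟨m, hm, k, rfl⟩
    exact ⟨m, hm, _, ⟨k, rfl⟩, by rw [nsmul_eq_mul]⟩

/-- A positive element outside `M` is an atom of the monoid obtained by adjoining it to `M`. -/
theorem isAtom_sup_closure_singleton {M : AddSubmonoid ℚ} (hM : ∀ x ∈ M, (0 : ℚ) ≤ x)
    {r : ℚ} (hr : 0 < r) (hrM : r ∉ M) : IsAtom (M ⊔ AddSubmonoid.closure {r}) r := by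
  refine ⟨mem_sup_closure_singleton.2 ⟨0, M.zero_mem, 1, by simp⟩, hr.ne', ?_⟩
  intro b hb c hc hbc
  obtain ⟨m, hm, k, rfl⟩ := mem_sup_closure_singleton.1 hb
  obtain ⟨m', hm', k', rfl⟩ := mem_sup_closure_singleton.1 hc
  have h0 := hM m hm
  have h0' := hM m' hm'
  have hk : (0 : ℚ) ≤ k * r := by positivity
  have hk' : (0 : ℚ) ≤ k' * r := by positivity
  rcases Nat.eq_zero_or_pos k with rfl | hpos
  · rcases Nat.eq_zero_or_pos k' with rfl | hpos'
    · refine absurd ?_ hrM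
      rw [hbc]
      simpa using M.add_mem hm hm'
    · have : (1 : ℚ) ≤ k' := by exact_mod_cast hpos'
      left
      nlinarith
  · have : (1 : ℚ) ≤ k := by exact_mod_cast hpos
    right
    nlinarith

/-- An atom of `M` that is no longer an atom after adjoining `r` differs from an element of `M`
by a positive multiple of `r`. -/
theorem exists_add_mul_eq_of_not_isAtom {M : AddSubmonoid ℚ} {r a : ℚ} (ha : IsAtom M a)
    (ha' : ¬ IsAtom (M ⊔ AddSubmonoid.closure {r}) a) :
    ∃ m ∈ M, ∃ k : ℕ, 1 ≤ k ∧ m + k * r = a := by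
  by_contra! hno
  refine ha' ⟨(le_sup_left : M ≤ _) ha.1, ha.2.1, ?_⟩
  intro b hb c hc hbc
  obtain ⟨m, hm, k, rfl⟩ := mem_sup_closure_singleton.1 hb
  obtain ⟨m', hm', k', rfl⟩ := mem_sup_closure_singleton.1 hc
  have hk : k + k' = 0 := by
    by_contra hne
    refine hno (m + m') (M.add_mem hm hm') (k + k') (by omega) ?_
    rw [hbc]
    push_cast
    ring
  obtain ⟨rfl, rfl⟩ : k = 0 ∧ k' = 0 := by omega
  simp only [Nat.cast_zero, zero_mul, add_zero] at hbc ⊢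
  exact ha.2.2 m hm m' hm' hbc

theorem Atomic.sup_closure_singleton {M : AddSubmonoid ℚ} (hatomic : Atomic M)
    (hM : ∀ x ∈ M, (0 : ℚ) ≤ x) {r : ℚ} (hr : 0 ≤ r) :
    Atomic (M ⊔ AddSubmonoid.closure {r}) := by
  by_cases hrM : r ∈ M
  · rwa [sup_eq_left.2 ((AddSubmonoid.closure_le).2 (Set.singleton_subset_iff.2 hrM))]
  have hpos : 0 < r := hr.lt_of_ne fun h => hrM (h ▸ M.zero_mem)
  have hrC := AddSubmonoid.subset_closure
    (s := {a : ℚ | IsAtom (M ⊔ AddSubmonoid.closure {r}) a})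
    (isAtom_sup_closure_singleton hM hpos hrM)
  set C := AddSubmonoid.closure {a : ℚ | IsAtom (M ⊔ AddSubmonoid.closure {r}) a} with hC
  have hmul (k : ℕ) : (k : ℚ) * r ∈ C := by
    rw [← nsmul_eq_mul]
    exact C.nsmul_mem hrC k
  have key (n : ℕ) : ∀ x ∈ M, x < n * r → x ∈ C := by
    induction n with
    | zero =>
      intro x hx hlt
      simp only [Nat.cast_zero, zero_mul] at hlt
      exact absurd (hM x hx) hlt.not_ge
    | succ n ih =>
      intro x hx
      refine AddSubmonoid.closure_induction
        (motive := fun y _ => y < ((n + 1 : ℕ) : ℚ) * r → y ∈ C) ?_ ?_ ?_ (hatomic x hx)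
      · intro a ha hlt
        by_cases ha' : IsAtom (M ⊔ AddSubmonoid.closure {r}) a
        · exact AddSubmonoid.subset_closure ha'
        obtain ⟨m, hm, k, hk, rfl⟩ := exists_add_mul_eq_of_not_isAtom ha ha'
        have hk : (1 : ℚ) ≤ k := by exact_mod_cast hk
        refine C.add_mem (ih m hm ?_) (hmul k)
        push_cast at hlt
        nlinarith
      · exact fun _ => C.zero_mem
      · intro y z hy hz ihy ihz hlt
        have hy0 := hM y (closure_isAtom_le M hy)
        have hz0 := hM z (closure_isAtom_le M hz)
        exact C.add_mem (ihy (by linarith)) (ihz (by linarith))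
  intro x hx
  obtain ⟨m, hm, k, rfl⟩ := mem_sup_closure_singleton.1 hx
  obtain ⟨n, hn⟩ := exists_nat_gt (m / r)
  exact C.add_mem (key n m hm ((div_lt_iff₀ hpos).1 hn)) (hmul k)

/-- If `M` and `N` are Puiseux monoids such that `N` is finitely generated and
`M` is atomic, then the internal sum `M + N` is atomic. -/
theorem atomic_sup_of_atomic_of_fg (M N : AddSubmonoid ℚ)
    (hM : ∀ x ∈ M, (0 : ℚ) ≤ x) (hN : ∀ x ∈ N, (0 : ℚ) ≤ x)
    (hfg : N.FG) (hatomic : Atomic M) :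
    Atomic (M ⊔ N) := by
  obtain ⟨S, rfl⟩ := hfg
  induction S using Finset.induction_on with
  | empty => simpa using hatomic
  | insert r S _ ih =>
    have hsub : AddSubmonoid.closure (S : Set ℚ) ≤
        AddSubmonoid.closure ((insert r S : Finset ℚ) : Set ℚ) :=
      AddSubmonoid.closure_mono (by simp)
    have hr : 0 ≤ r := hN r (AddSubmonoid.subset_closure (by simp))
    have hS : ∀ x ∈ AddSubmonoid.closure (S : Set ℚ), (0 : ℚ) ≤ x := fun x hx => hN x (hsub hx)
    have hMS : ∀ x ∈ M ⊔ AddSubmonoid.closure (S : Set ℚ), (0 : ℚ) ≤ x := by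
      intro x hx
      obtain ⟨m, hm, s, hs, rfl⟩ := AddSubmonoid.mem_sup.1 hx
      exact add_nonneg (hM m hm) (hS s hs)
    rw [Finset.coe_insert, Set.insert_eq, AddSubmonoid.closure_union,
      sup_comm (AddSubmonoid.closure {r}), ← sup_assoc]
    exact (ih hS).sup_closure_singleton hMS hr

end PuiseuxSum
end

section
/- Let M and N be Puiseux monoids such that N is finitely generated. If M is a finite factorization monoid (FFM), then the internal sum M + N is an FFM. -/
namespace PuiseuxSum

/-- A factorization of `q` in `M` is a multiset of atoms of `M` whose sum
is `q`. -/
def IsFactorization (M : AddSubmonoid ℚ) (q : ℚ) (s : Multiset ℚ) : Prop :=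
  (∀ a ∈ s, IsAtom M a) ∧ s.sum = q

/-- `M` is a finite factorization monoid (FFM) if it is atomic and every
element of `M` has only finitely many factorizations. -/
def FFM (M : AddSubmonoid ℚ) : Prop :=
  Atomic M ∧ ∀ q ∈ M, {s : Multiset ℚ | IsFactorization M q s}.Finite

/-- `M` is a bounded factorization monoid (BFM) if it is atomic and for every
`q ∈ M` the set of lengths of factorizations of `q` is finite. -/
def BFM (M : AddSubmonoid ℚ) : Prop :=
  Atomic M ∧
    ∀ q ∈ M, {ℓ : ℕ | ∃ s : Multiset ℚ, IsFactorization M q s ∧ Multiset.card s = ℓ}.Finite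

/-- `M` is a length-finite factorization monoid (LFFM) if it is atomic and for
every `q ∈ M` and every length `ℓ` there are only finitely many
factorizations of `q` of length `ℓ`. -/
def LFFM (M : AddSubmonoid ℚ) : Prop :=
  Atomic M ∧
    ∀ q ∈ M, ∀ ℓ : ℕ,
      {s : Multiset ℚ | IsFactorization M q s ∧ Multiset.card s = ℓ}.Finite

/-- The divisors of `x` in `M`. -/
def divisors (M : AddSubmonoid ℚ) (x : ℚ) : Set ℚ :=
  {d | d ∈ M ∧ x - d ∈ M}

theorem divisors_ssubset {M : AddSubmonoid ℚ} (hM : ∀ x ∈ M, (0 : ℚ) ≤ x) {b c : ℚ}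
    (hb : b ∈ M) (hc : c ∈ M) (hc0 : c ≠ 0) : divisors M b ⊂ divisors M (b + c) := by
  refine ⟨fun d hd => ⟨hd.1, ?_⟩, fun hsub => ?_⟩
  · rw [show b + c - d = (b - d) + c by ring]
    exact M.add_mem hd.2 hc
  · have h1 : b + c ∈ divisors M (b + c) := ⟨M.add_mem hb hc, by simp⟩
    have h2 := hM _ (hsub h1).2
    exact hc0 (le_antisymm (by linarith) (hM c hc))

theorem FFM.finite_divisors {M : AddSubmonoid ℚ} (h : FFM M) (x : ℚ) :
    (divisors M x).Finite := by
  by_cases hx : x ∈ M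
  · refine (((h.2 x hx).biUnion fun u _ => Set.finite_Iic u).image Multiset.sum).subset ?_
    rintro d ⟨hd, hd'⟩
    obtain ⟨s, hs, rfl⟩ := AddSubmonoid.exists_multiset_of_mem_closure (h.1 d hd)
    obtain ⟨t, ht, ht'⟩ := AddSubmonoid.exists_multiset_of_mem_closure (h.1 _ hd')
    refine ⟨s, Set.mem_biUnion (x := s + t) ⟨fun a ha => ?_, ?_⟩ (Multiset.le_add_right s t), rfl⟩
    · exact (Multiset.mem_add.1 ha).elim (hs a) (ht a)
    · rw [Multiset.sum_add, ht']
      ring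
  · convert Set.finite_empty
    refine Set.eq_empty_of_forall_notMem fun d hd => hx ?_
    simpa using M.add_mem hd.1 hd.2

theorem FFM.of_finite_divisors {M : AddSubmonoid ℚ} (hM : ∀ x ∈ M, (0 : ℚ) ≤ x)
    (h : ∀ x ∈ M, (divisors M x).Finite) : FFM M := by
  suffices H : ∀ n : ℕ, ∀ x ∈ M, (divisors M x).ncard = n →
      x ∈ AddSubmonoid.closure {a : ℚ | IsAtom M a} ∧
        {s : Multiset ℚ | IsFactorization M x s}.Finite from
    ⟨fun x hx => (H _ x hx rfl).1, fun x hx => (H _ x hx rfl).2⟩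
  intro n
  induction n using Nat.strong_induction_on with
  | _ n ih =>
  rintro x hx rfl
  have key : ∀ b ∈ M, ∀ c ∈ M, c ≠ 0 → x = b + c →
      b ∈ AddSubmonoid.closure {a : ℚ | IsAtom M a} ∧
        {s : Multiset ℚ | IsFactorization M b s}.Finite := by
    rintro b hb c hc hc0 rfl
    exact ih _ (Set.ncard_lt_ncard (divisors_ssubset hM hb hc hc0) (h _ hx)) b hb rfl
  constructor
  · by_cases hx0 : x = 0
    · rw [hx0]
      exact zero_mem _
    by_cases hatom : IsAtom M x
    · exact AddSubmonoid.subset_closure hatom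
    · simp only [IsAtom, not_and] at hatom
      have hsplit := hatom hx hx0
      push Not at hsplit
      obtain ⟨b, hb, c, hc, hbc, hb0, hc0⟩ := hsplit
      have hb' := (key b hb c hc hc0 hbc).1
      have hc' := (key c hc b hb hb0 (by rw [hbc, add_comm])).1
      rw [hbc]
      exact add_mem hb' hc'
  · have hfin : (⋃ a ∈ divisors M x \ {0},
        (fun s => a ::ₘ s) '' {s : Multiset ℚ | IsFactorization M (x - a) s}).Finite :=
      ((h x hx).subset Set.sdiff_subset).biUnion fun a ha =>
        (key (x - a) ha.1.2 a ha.1.1 ha.2 (by ring)).2.image _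
    refine (hfin.insert 0).subset ?_
    rintro s ⟨hs, hsum⟩
    induction s using Multiset.induction_on with
    | empty => exact Set.mem_insert _ _
    | cons a s _ =>
      right
      have hs' : ∀ b ∈ s, IsAtom M b := fun b hb => hs b (Multiset.mem_cons_of_mem hb)
      have ha := hs a (Multiset.mem_cons_self a s)
      have hxa : s.sum = x - a := by
        rw [← hsum, Multiset.sum_cons]
        ring
      refine Set.mem_biUnion (x := a) ⟨⟨ha.1, ?_⟩, ha.2.1⟩ ⟨s, ⟨hs', hxa⟩, rfl⟩
      rw [← hxa]
      exact M.multiset_sum_mem s fun b hb => (hs' b hb).1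

theorem finite_le_of_fg {N : AddSubmonoid ℚ} (hN : ∀ x ∈ N, (0 : ℚ) ≤ x) (hfg : N.FG) (q : ℚ) :
    {n | n ∈ N ∧ n ≤ q}.Finite := by
  obtain ⟨S, rfl⟩ := hfg
  set D : ℕ := ∏ a ∈ S, a.den with hD
  have hDpos : (0 : ℚ) < D := by
    exact_mod_cast Finset.prod_pos fun (a : ℚ) _ => a.den_pos
  have hint : ∀ n ∈ AddSubmonoid.closure (S : Set ℚ), ∃ z : ℤ, (z : ℚ) = D * n := by
    intro n hn
    induction hn using AddSubmonoid.closure_induction with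
    | mem a ha =>
      obtain ⟨k, hk⟩ : a.den ∣ D := Finset.dvd_prod_of_mem _ ha
      refine ⟨k * a.num, ?_⟩
      rw [hk]
      push_cast
      rw [← Rat.mul_den_eq_num a]
      ring
    | zero => exact ⟨0, by simp⟩
    | add a b _ _ ha hb =>
      obtain ⟨y, hy⟩ := ha
      obtain ⟨z, hz⟩ := hb
      exact ⟨y + z, by push_cast; rw [hy, hz]; ring⟩
  refine ((Set.finite_Icc (0 : ℤ) ⌊D * q⌋).image fun z : ℤ => (z : ℚ) / D).subset ?_
  rintro n ⟨hn, hnq⟩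
  obtain ⟨z, hz⟩ := hint n hn
  refine ⟨z, ⟨?_, Int.le_floor.2 ?_⟩, ?_⟩
  · have : (0 : ℚ) ≤ z := hz ▸ mul_nonneg hDpos.le (hN n hn)
    exact_mod_cast this
  · rw [hz]
    gcongr
  · simp only [hz]
    field_simp

/-- If `M` and `N` are Puiseux monoids such that `N` is finitely generated and
`M` is a FFM, then the internal sum `M + N` is a FFM. -/
theorem ffm_sup_of_ffm_of_fg (M N : AddSubmonoid ℚ)
    (hM : ∀ x ∈ M, (0 : ℚ) ≤ x) (hN : ∀ x ∈ N, (0 : ℚ) ≤ x)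
    (hfg : N.FG) (h : FFM M) :
    FFM (M ⊔ N) := by
  refine FFM.of_finite_divisors (fun x hx => ?_) fun x _ => ?_
  · obtain ⟨m, hm, n, hn, rfl⟩ := AddSubmonoid.mem_sup.1 hx
    exact add_nonneg (hM m hm) (hN n hn)
  · have hfin := finite_le_of_fg hN hfg x
    refine (Set.Finite.image2 (· + ·)
      (hfin.biUnion fun k _ => h.finite_divisors (x - k)) hfin).subset ?_
    rintro d ⟨hd, hd'⟩
    obtain ⟨m, hm, n, hn, rfl⟩ := AddSubmonoid.mem_sup.1 hd
    obtain ⟨m', hm', n', hn', hsum⟩ := AddSubmonoid.mem_sup.1 hd'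
    have h1 := hM m hm
    have h2 := hM m' hm'
    have h3 := hN n' hn'
    refine ⟨m, Set.mem_biUnion (x := n + n') ⟨N.add_mem hn hn', by linarith⟩ ⟨hm, ?_⟩,
      n, ⟨hn, by linarith⟩, rfl⟩
    rwa [show x - (n + n') - m = m' by linarith]

end PuiseuxSum
end

section
/- Let M and N be Puiseux monoids such that N is finitely generated. If M is a bounded factorization monoid (BFM), then the internal sum M + N is a BFM. -/
namespace PuiseuxSum

/-- For every `q` the number of summands in an expression of `q` as a sum of nonzero elements of
`M` is bounded. -/
def BoundedSums (M : AddSubmonoid ℚ) : Prop :=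
  ∀ q : ℚ, ∃ n : ℕ, ∀ s : Multiset ℚ, (∀ x ∈ s, x ∈ M ∧ x ≠ 0) → s.sum = q → s.card ≤ n

/-- In an atomic monoid, a sum of nonzero elements refines to a sum of atoms. -/
theorem Atomic.exists_refinement {M : AddSubmonoid ℚ} (h : Atomic M) (s : Multiset ℚ)
    (hs : ∀ x ∈ s, x ∈ M ∧ x ≠ 0) :
    ∃ t : Multiset ℚ, IsFactorization M s.sum t ∧ s.card ≤ t.card := by
  induction s using Multiset.induction_on with
  | empty => exact ⟨0, ⟨by simp, by simp⟩, le_rfl⟩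
  | cons x s ih =>
    obtain ⟨t, ⟨ht, hsum⟩, hcard⟩ := ih fun y hy => hs y (Multiset.mem_cons_of_mem hy)
    obtain ⟨hxM, hx0⟩ := hs x (Multiset.mem_cons_self x s)
    obtain ⟨u, hu, husum⟩ := AddSubmonoid.exists_multiset_of_mem_closure (h x hxM)
    have hu0 : 0 < u.card := by
      rw [Multiset.card_pos]
      rintro rfl
      exact hx0 (by simpa using husum.symm)
    refine ⟨u + t, ⟨fun a ha => ?_, by simp [hsum, husum]⟩, ?_⟩
    · exact (Multiset.mem_add.mp ha).elim (hu a) (ht a)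
    · rw [Multiset.card_cons, Multiset.card_add]
      lia

theorem BFM.boundedSums {M : AddSubmonoid ℚ} (h : BFM M) : BoundedSums M := by
  intro q
  by_cases hq : q ∈ M
  · obtain ⟨n, hn⟩ := (h.2 q hq).bddAbove
    refine ⟨n, fun s hs hsum => ?_⟩
    obtain ⟨t, ht, hcard⟩ := h.1.exists_refinement s hs
    exact hcard.trans (hn ⟨t, hsum ▸ ht, rfl⟩)
  · exact ⟨0, fun s hs hsum =>
      absurd (hsum ▸ M.multiset_sum_mem s fun x hx => (hs x hx).1) hq⟩

theorem BoundedSums.atomic {M : AddSubmonoid ℚ} (h : BoundedSums M) : Atomic M := by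
  intro x hx
  obtain ⟨n, hn⟩ := h x
  induction n generalizing x with
  | zero =>
    by_cases hx0 : x = 0
    · exact hx0 ▸ zero_mem _
    · simpa using hn {x} (by simp [hx, hx0]) (by simp)
  | succ n ih =>
    by_cases hx0 : x = 0
    · exact hx0 ▸ zero_mem _
    by_cases hatom : IsAtom M x
    · exact AddSubmonoid.subset_closure hatom
    have hsplit : ∃ b ∈ M, ∃ c ∈ M, x = b + c ∧ b ≠ 0 ∧ c ≠ 0 := by
      by_contra! hcon
      exact hatom ⟨hx, hx0, fun b hb c hc hbc => or_iff_not_imp_left.mpr (hcon b hb c hc hbc)⟩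
    obtain ⟨b, hb, c, hc, rfl, hb0, hc0⟩ := hsplit
    have key : ∀ y z : ℚ, z ∈ M → z ≠ 0 → y + z = b + c → ∀ s : Multiset ℚ,
        (∀ x ∈ s, x ∈ M ∧ x ≠ 0) → s.sum = y → s.card ≤ n := by
      intro y z hz hz0 hyz s hs hsum
      have := hn (z ::ₘ s) (Multiset.forall_mem_cons.mpr ⟨⟨hz, hz0⟩, hs⟩)
        (by rw [Multiset.sum_cons, hsum, add_comm, hyz])
      simpa using this
    exact add_mem (ih b hb (key b c hc hc0 rfl)) (ih c hc (key c b hb hb0 (add_comm c b)))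

theorem BoundedSums.bfm {M : AddSubmonoid ℚ} (h : BoundedSums M) : BFM M := by
  refine ⟨h.atomic, fun q _ => ?_⟩
  obtain ⟨n, hn⟩ := h q
  refine (Set.finite_Iic n).subset ?_
  rintro _ ⟨s, ⟨hs, hsum⟩, rfl⟩
  exact hn s (fun x hx => ⟨(hs x hx).1, (hs x hx).2.1⟩) hsum

/-- A sum of nonzero elements of `M + ℕ a` is a sum of nonzero elements of `M` plus a multiple
of `a`, where the total number of summands does not decrease. -/
theorem exists_multiset_add_nsmul {M : AddSubmonoid ℚ} {a : ℚ} (s : Multiset ℚ)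
    (hs : ∀ x ∈ s, x ∈ M ⊔ AddSubmonoid.closure {a} ∧ x ≠ 0) :
    ∃ (t : Multiset ℚ) (c : ℕ), (∀ x ∈ t, x ∈ M ∧ x ≠ 0) ∧ s.sum = t.sum + c • a ∧
      s.card ≤ t.card + c := by
  induction s using Multiset.induction_on with
  | empty => exact ⟨0, 0, by simp⟩
  | cons x s ih =>
    obtain ⟨t, c, ht, hsum, hcard⟩ := ih fun y hy => hs y (Multiset.mem_cons_of_mem hy)
    obtain ⟨hx, hx0⟩ := hs x (Multiset.mem_cons_self x s)
    obtain ⟨m, hm, y, hy, rfl⟩ := AddSubmonoid.mem_sup.mp hx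
    obtain ⟨k, rfl⟩ := AddSubmonoid.mem_closure_singleton.mp hy
    by_cases hm0 : m = 0
    · have hk : k ≠ 0 := by
        rintro rfl
        simp [hm0] at hx0
      refine ⟨t, c + k, ht, ?_, ?_⟩
      · rw [Multiset.sum_cons, hsum, hm0, add_nsmul]
        ring
      · rw [Multiset.card_cons]
        lia
    · refine ⟨m ::ₘ t, c + k, Multiset.forall_mem_cons.mpr ⟨⟨hm, hm0⟩, ht⟩, ?_, ?_⟩
      · rw [Multiset.sum_cons, Multiset.sum_cons, hsum, add_nsmul]
        ring
      · rw [Multiset.card_cons, Multiset.card_cons]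
        lia

theorem BoundedSums.sup_closure_singleton {M : AddSubmonoid ℚ} (h : BoundedSums M)
    (hM : ∀ x ∈ M, 0 ≤ x) {a : ℚ} (ha : 0 ≤ a) :
    BoundedSums (M ⊔ AddSubmonoid.closure {a}) := by
  obtain rfl | ha := ha.eq_or_lt
  · simpa using h
  choose f hf using h
  intro q
  refine ⟨(Finset.range (⌊q / a⌋₊ + 1)).sup (fun c => f (q - c • a)) + ⌊q / a⌋₊,
    fun s hs hsum => ?_⟩
  obtain ⟨t, c, ht, hts, hcard⟩ := exists_multiset_add_nsmul s hs
  have ht0 : 0 ≤ t.sum := Multiset.sum_nonneg fun x hx => hM x (ht x hx).1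
  have hc : c ≤ ⌊q / a⌋₊ := by
    refine Nat.le_floor ((le_div_iff₀ ha).mpr ?_)
    rw [nsmul_eq_mul] at hts
    linarith
  have htc : t.card ≤ f (q - c • a) := hf _ t ht (by rw [← hsum, hts, add_sub_cancel_right])
  have hsup := Finset.le_sup (f := fun c : ℕ => f (q - c • a))
    (Finset.mem_range.mpr (Nat.lt_succ_of_le hc))
  exact hcard.trans (add_le_add (htc.trans hsup) hc)

theorem BoundedSums.sup_closure {M : AddSubmonoid ℚ} (h : BoundedSums M)
    (hM : ∀ x ∈ M, 0 ≤ x) (S : Finset ℚ) (hS : ∀ x ∈ S, 0 ≤ x) :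
    BoundedSums (M ⊔ AddSubmonoid.closure (S : Set ℚ)) := by
  induction S using Finset.induction_on with
  | empty => simpa using h
  | insert a S _ ih =>
    have hS' : ∀ x ∈ S, 0 ≤ x := fun x hx => hS x (Finset.mem_insert_of_mem hx)
    have hle : M ⊔ AddSubmonoid.closure (S : Set ℚ) ≤ AddSubmonoid.nonneg ℚ :=
      sup_le hM (AddSubmonoid.closure_le.mpr hS')
    rw [Finset.coe_insert, Set.insert_eq, Set.union_comm, AddSubmonoid.closure_union, ← sup_assoc]
    exact (ih hS').sup_closure_singleton hle (hS a (Finset.mem_insert_self a S))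

/-- If `M` and `N` are Puiseux monoids such that `N` is finitely generated and
`M` is a BFM, then the internal sum `M + N` is a BFM. -/
theorem bfm_sup_of_bfm_of_fg (M N : AddSubmonoid ℚ)
    (hM : ∀ x ∈ M, (0 : ℚ) ≤ x) (hN : ∀ x ∈ N, (0 : ℚ) ≤ x)
    (hfg : N.FG) (h : BFM M) :
    BFM (M ⊔ N) := by
  obtain ⟨S, rfl⟩ := hfg
  exact (h.boundedSums.sup_closure hM S fun x hx =>
    hN x (AddSubmonoid.subset_closure hx)).bfm

end PuiseuxSum
end

section
/- Let M₂ be the additive submonoid {(0,0)} ∪ (ℤ × ℕ≥1) of ℤ². Then the set of atoms of M₂ is {(n,1) : n ∈ ℤ}, and M₂ is strongly atomic. -/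
namespace LatticeSum

/-- `u` is invertible in the additive submonoid `M` of `ℤ × ℤ`
(for `u ∈ M`) if `-u ∈ M`. -/
def Invertible' (M : AddSubmonoid (ℤ × ℤ)) (u : ℤ × ℤ) : Prop :=
  -u ∈ M

/-- `a` is an atom of `M`: a non-invertible element of `M` such that whenever
`a = b + c` with `b, c ∈ M`, `b` or `c` is invertible in `M`. -/
def IsAtom (M : AddSubmonoid (ℤ × ℤ)) (a : ℤ × ℤ) : Prop :=
  a ∈ M ∧ ¬ Invertible' M a ∧
    ∀ b ∈ M, ∀ c ∈ M, a = b + c → Invertible' M b ∨ Invertible' M c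

/-- `M` is atomic if every non-invertible element of `M` is a finite sum of
atoms of `M`. -/
def Atomic (M : AddSubmonoid (ℤ × ℤ)) : Prop :=
  ∀ x ∈ M, ¬ Invertible' M x →
    ∃ s : Multiset (ℤ × ℤ), (∀ a ∈ s, IsAtom M a) ∧ s.sum = x

/-- `c` divides `b` in `M` if `b = c + d` for some `d ∈ M`. -/
def DividesIn (M : AddSubmonoid (ℤ × ℤ)) (c b : ℤ × ℤ) : Prop :=
  ∃ d ∈ M, b = c + d

/-- `d` is a maximal common divisor of `x` and `y` in `M`: a common divisor of
`x` and `y` such that every common divisor in `M` of `x - d` and `y - d` is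
invertible in `M`. -/
def IsMCD (M : AddSubmonoid (ℤ × ℤ)) (x y d : ℤ × ℤ) : Prop :=
  d ∈ M ∧ DividesIn M d x ∧ DividesIn M d y ∧
    ∀ e ∈ M, DividesIn M e (x - d) → DividesIn M e (y - d) → Invertible' M e

/-- `M` is strongly atomic if it is atomic and every pair of elements of `M`
has a maximal common divisor in `M`. -/
def StronglyAtomic (M : AddSubmonoid (ℤ × ℤ)) : Prop :=
  Atomic M ∧ ∀ x ∈ M, ∀ y ∈ M, ∃ d, IsMCD M x y d

/-- The additive submonoid `{(0,0)} ∪ (ℤ × ℕ≥1)` of `ℤ²`. -/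
def M₂ : AddSubmonoid (ℤ × ℤ) where
  carrier := {v : ℤ × ℤ | v = 0 ∨ 1 ≤ v.2}
  zero_mem' := Or.inl rfl
  add_mem' := by
    rintro a b (rfl | ha) (rfl | hb)
    · exact Or.inl (by simp)
    · exact Or.inr (by simpa using hb)
    · exact Or.inr (by simpa using ha)
    · exact Or.inr (by simpa using by omega)

/-- The additive submonoid `ℕ₀ × ℕ₀` of `ℤ²`. -/
def M₁ : AddSubmonoid (ℤ × ℤ) where
  carrier := {v : ℤ × ℤ | 0 ≤ v.1 ∧ 0 ≤ v.2}
  zero_mem' := ⟨le_refl 0, le_refl 0⟩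
  add_mem' := by
    rintro a b ⟨h1, h2⟩ ⟨h3, h4⟩
    exact ⟨add_nonneg h1 h3, add_nonneg h2 h4⟩

theorem mem_M₂ {v : ℤ × ℤ} : v ∈ M₂ ↔ v = 0 ∨ 1 ≤ v.2 := Iff.rfl

theorem snd_nonneg_of_mem_M₂ {v : ℤ × ℤ} (hv : v ∈ M₂) : 0 ≤ v.2 := by
  rcases hv with rfl | hv
  · exact le_rfl
  · omega

/-- The only invertible element of `M₂` is `0`. -/
theorem invertible'_M₂_iff {v : ℤ × ℤ} (hv : v ∈ M₂) : Invertible' M₂ v ↔ v = 0 := by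
  constructor
  · rintro (h | h)
    · exact neg_eq_zero.mp h
    · have := snd_nonneg_of_mem_M₂ hv
      rw [Prod.snd_neg] at h
      omega
  · rintro rfl
    exact Or.inl neg_zero

theorem isAtom_M₂_iff {a : ℤ × ℤ} : IsAtom M₂ a ↔ a.2 = 1 := by
  constructor
  · rintro ⟨ha, hinv, hsplit⟩
    rw [invertible'_M₂_iff ha] at hinv
    have h1 : 1 ≤ a.2 := (mem_M₂.mp ha).resolve_left hinv
    by_contra hne
    have hb : ((0, 1) : ℤ × ℤ) ∈ M₂ := Or.inr le_rfl
    have hc : ((a.1, a.2 - 1) : ℤ × ℤ) ∈ M₂ := Or.inr (by dsimp only; omega)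
    rcases hsplit _ hb _ hc (by ext <;> simp) with h | h
    · rw [invertible'_M₂_iff hb] at h
      simp at h
    · rw [invertible'_M₂_iff hc, Prod.ext_iff] at h
      have : a.2 - 1 = 0 := h.2
      omega
  · intro h
    have ha : a ∈ M₂ := Or.inr h.ge
    refine ⟨ha, ?_, ?_⟩
    · rw [invertible'_M₂_iff ha]
      rintro rfl
      simp at h
    · intro b hb c hc habc
      rw [invertible'_M₂_iff hb, invertible'_M₂_iff hc]
      have hsum : a.2 = b.2 + c.2 := by rw [habc, Prod.snd_add]
      rcases hb with hb | hb
      · exact Or.inl hb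
      rcases hc with hc | hc
      · exact Or.inr hc
      omega

theorem atomic_M₂ : Atomic M₂ := by
  intro x hx hinv
  rw [invertible'_M₂_iff hx] at hinv
  have h1 : 1 ≤ x.2 := (mem_M₂.mp hx).resolve_left hinv
  refine ⟨(x.1, 1) ::ₘ Multiset.replicate (x.2 - 1).toNat (0, 1), ?_, ?_⟩
  · intro a ha
    rw [isAtom_M₂_iff]
    rcases Multiset.mem_cons.mp ha with rfl | ha
    · rfl
    · rw [Multiset.eq_of_mem_replicate ha]
  · rw [Multiset.sum_cons, Multiset.sum_replicate]
    ext
    · simp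
    · simp
      omega

/-- Adding a common divisor `e` to a maximal common divisor of `x - e` and `y - e` gives
a maximal common divisor of `x` and `y`. -/
theorem IsMCD.add_of_sub {M : AddSubmonoid (ℤ × ℤ)} {x y e d : ℤ × ℤ} (he : e ∈ M)
    (h : IsMCD M (x - e) (y - e) d) : IsMCD M x y (e + d) := by
  obtain ⟨hd, ⟨u, hu, hxu⟩, ⟨v, hv, hyv⟩, hmax⟩ := h
  refine ⟨M.add_mem he hd, ⟨u, hu, ?_⟩, ⟨v, hv, ?_⟩, ?_⟩
  · rw [add_assoc, ← hxu, add_sub_cancel]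
  · rw [add_assoc, ← hyv, add_sub_cancel]
  · simpa only [sub_sub] using hmax

theorem exists_isMCD_M₂ {x y : ℤ × ℤ} (hx : x ∈ M₂) (hy : y ∈ M₂) :
    ∃ d, IsMCD M₂ x y d := by
  induction hn : x.2.toNat using Nat.strong_induction_on generalizing x y with
  | _ n ih =>
    by_cases hdiv : ∀ e ∈ M₂, DividesIn M₂ e x → DividesIn M₂ e y → Invertible' M₂ e
    · exact ⟨0, M₂.zero_mem, ⟨x, hx, (zero_add x).symm⟩, ⟨y, hy, (zero_add y).symm⟩,
        by simpa only [sub_zero] using hdiv⟩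
    · push Not at hdiv
      obtain ⟨e, he, ⟨u, hu, rfl⟩, ⟨v, hv, rfl⟩, hinv⟩ := hdiv
      rw [invertible'_M₂_iff he] at hinv
      have h1 : 1 ≤ e.2 := (mem_M₂.mp he).resolve_left hinv
      have hu0 := snd_nonneg_of_mem_M₂ hu
      rw [Prod.snd_add] at hn
      obtain ⟨d, hd⟩ := ih u.2.toNat (by omega) hu hv rfl
      exact ⟨e + d, IsMCD.add_of_sub he (by simpa only [add_sub_cancel_left] using hd)⟩

/-- The set of atoms of `M₂ = {(0,0)} ∪ (ℤ × ℕ≥1)` is `{(n,1) : n ∈ ℤ}`, and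
`M₂` is strongly atomic. -/
theorem atoms_M₂_and_stronglyAtomic :
    {a : ℤ × ℤ | IsAtom M₂ a} = {v : ℤ × ℤ | ∃ n : ℤ, v = (n, 1)} ∧
      StronglyAtomic M₂ := by
  refine ⟨?_, atomic_M₂, fun x hx y hy => exists_isMCD_M₂ hx hy⟩
  ext a
  simp only [Set.mem_ofPred_eq, isAtom_M₂_iff]
  constructor
  · intro h
    exact ⟨a.1, Prod.ext rfl h⟩
  · rintro ⟨n, rfl⟩
    rfl

end LatticeSum
end

section
/- Let M₁ := ℕ₀ × ℕ₀ and M₂ := {(0,0)} ∪ (ℤ × ℕ≥1), both additive submonoids of ℤ², and let M := M₁ + M₂ be their internal sum. Then M = M₁ ∪ M₂ (equivalently, M is the nonnegative cone of ℤ² under the lexicographic order with priority on the second coordinate), the only atom of M is (1,0), and M is not atomic: the set of elements of M that are finite sums of atoms is exactly {(m,0) : m ∈ ℕ₀}. -/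
namespace LatticeSum

theorem mem_sup_iff (v : ℤ × ℤ) :
    v ∈ M₁ ⊔ M₂ ↔ 1 ≤ v.2 ∨ (v.2 = 0 ∧ 0 ≤ v.1) := by
  rw [AddSubmonoid.mem_sup]
  constructor
  · rintro ⟨y, ⟨hy1, hy2⟩, z, hz, rfl⟩
    rcases hz with rfl | hz <;> simp only [Prod.fst_add, Prod.snd_add, Prod.fst_zero, Prod.snd_zero]
    <;> omega
  · rintro (h | ⟨h, h'⟩)
    · exact ⟨0, M₁.zero_mem, v, Or.inr h, zero_add v⟩
    · exact ⟨v, ⟨h', h.ge⟩, 0, M₂.zero_mem, add_zero v⟩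

theorem invertible'_sup_iff {v : ℤ × ℤ} (hv : v ∈ M₁ ⊔ M₂) :
    Invertible' (M₁ ⊔ M₂) v ↔ v.1 = 0 ∧ v.2 = 0 := by
  rw [mem_sup_iff] at hv
  rw [Invertible', mem_sup_iff, Prod.fst_neg, Prod.snd_neg]
  omega

theorem isAtom_sup_iff (a : ℤ × ℤ) : IsAtom (M₁ ⊔ M₂) a ↔ a = (1, 0) := by
  constructor
  · rintro ⟨ha, hu, hab⟩
    have h1 : ((1, 0) : ℤ × ℤ) ∈ M₁ ⊔ M₂ := by simp [mem_sup_iff]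
    rw [invertible'_sup_iff ha] at hu
    have hd : a - (1, 0) ∈ M₁ ⊔ M₂ := by
      rw [mem_sup_iff] at ha ⊢
      simp only [Prod.fst_sub, Prod.snd_sub]
      omega
    have h := hab _ h1 _ hd (add_sub_cancel _ _).symm
    rw [invertible'_sup_iff h1, invertible'_sup_iff hd] at h
    simp only [Prod.fst_sub, Prod.snd_sub] at h
    ext <;> simp only <;> omega
  · rintro rfl
    have h1 : ((1, 0) : ℤ × ℤ) ∈ M₁ ⊔ M₂ := by simp [mem_sup_iff]
    refine ⟨h1, by simp [invertible'_sup_iff h1], fun b hb c hc h => ?_⟩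
    rw [invertible'_sup_iff hb, invertible'_sup_iff hc]
    rw [mem_sup_iff] at hb hc
    simp only [Prod.ext_iff, Prod.fst_add, Prod.snd_add] at h
    omega

theorem exists_sum_isAtom_iff (x : ℤ × ℤ) :
    (∃ s : Multiset (ℤ × ℤ), (∀ a ∈ s, IsAtom (M₁ ⊔ M₂) a) ∧ s.sum = x) ↔
      ∃ m : ℕ, x = ((m : ℤ), 0) := by
  simp only [isAtom_sup_iff]
  constructor
  · rintro ⟨s, hs, rfl⟩
    refine ⟨s.card, ?_⟩
    rw [Multiset.eq_replicate_card.2 hs]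
    simp
  · rintro ⟨m, rfl⟩
    exact ⟨Multiset.replicate m (1, 0), fun a => Multiset.eq_of_mem_replicate, by simp⟩

/-- For `M := M₁ + M₂` (internal sum inside `ℤ²`): `M = M₁ ∪ M₂` as sets, the
only atom of `M` is `(1,0)`, the set of elements of `M` that are finite sums of
atoms of `M` is exactly `{(m,0) : m ∈ ℕ₀}`, and `M` is not atomic. -/
theorem sum_M₁_M₂_not_atomic :
    ((M₁ ⊔ M₂ : AddSubmonoid (ℤ × ℤ)) : Set (ℤ × ℤ)) = (M₁ : Set (ℤ × ℤ)) ∪ (M₂ : Set (ℤ × ℤ)) ∧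
      {a : ℤ × ℤ | IsAtom (M₁ ⊔ M₂) a} = {((1 : ℤ), (0 : ℤ))} ∧
      {x : ℤ × ℤ | x ∈ M₁ ⊔ M₂ ∧
          ∃ s : Multiset (ℤ × ℤ), (∀ a ∈ s, IsAtom (M₁ ⊔ M₂) a) ∧ s.sum = x} =
        {v : ℤ × ℤ | ∃ m : ℕ, v = ((m : ℤ), 0)} ∧
      ¬ Atomic (M₁ ⊔ M₂) := by
  refine ⟨?_, ?_, ?_, fun h => ?_⟩
  · ext v
    have h₁ : v ∈ M₁ ↔ 0 ≤ v.1 ∧ 0 ≤ v.2 := Iff.rfl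
    have h₂ : v ∈ M₂ ↔ v = 0 ∨ 1 ≤ v.2 := Iff.rfl
    simp only [Set.mem_union, SetLike.mem_coe, mem_sup_iff, h₁, h₂, Prod.ext_iff,
      Prod.fst_zero, Prod.snd_zero]
    omega
  · ext a
    exact isAtom_sup_iff a
  · ext x
    simp only [Set.mem_ofPred_eq, exists_sum_isAtom_iff, and_iff_right_iff_imp]
    rintro ⟨m, rfl⟩
    simp [mem_sup_iff]
  · have h01 : ((0, 1) : ℤ × ℤ) ∈ M₁ ⊔ M₂ := by simp [mem_sup_iff]
    obtain ⟨m, hm⟩ := (exists_sum_isAtom_iff _).1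
      (h _ h01 (by simp [invertible'_sup_iff h01]))
    simp at hm

end LatticeSum
end

section
/- For each n ∈ ℕ, let p_n denote the n-th odd prime, and let M₁ be the Puiseux monoid generated by the set S₁ := {1/(2ⁿ·p_n) : n ∈ ℕ}. Then M₁ is atomic and its set of atoms is exactly S₁. -/
namespace PuiseuxSum

/-- The generating set of Grams' monoid: `{1/(2ⁿ · pₙ) : n ∈ ℕ}`, where `pₙ`
is the `n`-th odd prime (so `pₙ = Nat.nth Nat.Prime n` for `n ≥ 1`). -/
def gramsSet : Set ℚ :=
  {q : ℚ | ∃ n : ℕ, 1 ≤ n ∧ q = 1 / (2 ^ n * (Nat.nth Nat.Prime n : ℚ))}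

theorem IsAtom.mem_of_closure {S : Set ℚ} {a : ℚ} (ha : IsAtom (AddSubmonoid.closure S) a) :
    a ∈ S := by
  obtain ⟨hmem, hne, hsplit⟩ := ha
  induction hmem using AddSubmonoid.closure_induction with
  | mem x hx => exact hx
  | zero => exact absurd rfl hne
  | add x y hx hy ihx ihy =>
    rcases hsplit x hx y hy rfl with rfl | rfl
    · rw [zero_add] at hne hsplit ⊢
      exact ihy hne hsplit
    · rw [add_zero] at hne hsplit ⊢
      exact ihx hne hsplit

theorem nonneg_of_mem_closure_gramsSet {x : ℚ} (hx : x ∈ AddSubmonoid.closure gramsSet) :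
    0 ≤ x := by
  induction hx using AddSubmonoid.closure_induction with
  | mem x hx =>
    obtain ⟨n, -, rfl⟩ := hx
    positivity
  | zero => exact le_rfl
  | add x y _ _ hx hy => exact add_nonneg hx hy

theorem not_nth_prime_dvd {k n : ℕ} (hk : 1 ≤ k) (hne : n ≠ k) :
    ¬ Nat.nth Nat.Prime k ∣ 2 ^ n * Nat.nth Nat.Prime n := by
  have hp := Nat.prime_nth_prime k
  have hinj := Nat.nth_injective Nat.infinite_setOfPred_prime
  rw [hp.dvd_mul, not_or]
  refine ⟨fun h => ?_, fun h => ?_⟩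
  · have h2 := (Nat.prime_dvd_prime_iff_eq hp Nat.prime_two).1 (hp.dvd_of_dvd_pow h)
    rw [← Nat.nth_prime_zero_eq_two] at h2
    have := hinj h2
    omega
  · exact hne (hinj ((Nat.prime_dvd_prime_iff_eq hp (Nat.prime_nth_prime n)).1 h)).symm

/-- An element of Grams' monoid that is not `pₖ`-integral involves the generator with
denominator `2ᵏ · pₖ`. -/
theorem padicNorm_le_one_or_le_of_mem_closure {k : ℕ} (hk : 1 ≤ k) {x : ℚ}
    (hx : x ∈ AddSubmonoid.closure gramsSet) :
    padicNorm (Nat.nth Nat.Prime k) x ≤ 1 ∨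
      1 / (2 ^ k * (Nat.nth Nat.Prime k : ℚ)) ≤ x := by
  have : Fact (Nat.nth Nat.Prime k).Prime := ⟨Nat.prime_nth_prime k⟩
  induction hx using AddSubmonoid.closure_induction with
  | mem x hx =>
    obtain ⟨n, -, rfl⟩ := hx
    by_cases hne : n = k
    · subst hne
      exact Or.inr le_rfl
    · left
      have h := (padicNorm.nat_eq_one_iff (p := Nat.nth Nat.Prime k) _).2 (not_nth_prime_dvd hk hne)
      push_cast at h
      rw [padicNorm.div, h, padicNorm.one, div_one]
  | zero => simp
  | add x y hx hy ihx ihy =>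
    have hx0 := nonneg_of_mem_closure_gramsSet hx
    have hy0 := nonneg_of_mem_closure_gramsSet hy
    rcases ihx with ihx | ihx
    · rcases ihy with ihy | ihy
      · exact Or.inl (padicNorm.nonarchimedean.trans (max_le ihx ihy))
      · exact Or.inr (by linarith)
    · exact Or.inr (by linarith)

theorem one_lt_padicNorm_generator (k : ℕ) :
    1 < padicNorm (Nat.nth Nat.Prime k) (1 / (2 ^ k * (Nat.nth Nat.Prime k : ℚ))) := by
  have hp := Nat.prime_nth_prime k
  have : Fact (Nat.nth Nat.Prime k).Prime := ⟨hp⟩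
  have h := (padicNorm.nat_lt_one_iff (p := Nat.nth Nat.Prime k) _).2
    (Dvd.intro_left (2 ^ k) (rfl : 2 ^ k * Nat.nth Nat.Prime k = _))
  push_cast at h
  rw [padicNorm.div, padicNorm.one]
  refine (one_lt_div (lt_of_le_of_ne (padicNorm.nonneg _) (Ne.symm ?_))).2 h
  have := hp.pos
  exact padicNorm.nonzero (by positivity)

theorem isAtom_of_mem_gramsSet {a : ℚ} (ha : a ∈ gramsSet) :
    IsAtom (AddSubmonoid.closure gramsSet) a := by
  refine ⟨AddSubmonoid.subset_closure ha, ?_⟩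
  obtain ⟨k, hk, rfl⟩ := ha
  have hp := Nat.prime_nth_prime k
  have : Fact (Nat.nth Nat.Prime k).Prime := ⟨hp⟩
  have hpos := hp.pos
  refine ⟨by positivity, fun b hb c hc habc => ?_⟩
  have hb0 := nonneg_of_mem_closure_gramsSet hb
  have hc0 := nonneg_of_mem_closure_gramsSet hc
  rcases padicNorm_le_one_or_le_of_mem_closure hk hb with hbk | hbk
  · rcases padicNorm_le_one_or_le_of_mem_closure hk hc with hck | hck
    · have h := one_lt_padicNorm_generator k
      rw [habc] at h
      exact absurd (padicNorm.nonarchimedean.trans (max_le hbk hck)) h.not_ge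
    · exact Or.inl (by linarith)
  · exact Or.inr (by linarith)

/-- Grams' monoid `M₁ := ⟨gramsSet⟩` is atomic, and its set of atoms is
exactly `gramsSet`. -/
theorem grams_atomic :
    Atomic (AddSubmonoid.closure gramsSet) ∧
      {a : ℚ | IsAtom (AddSubmonoid.closure gramsSet) a} = gramsSet := by
  have h : {a : ℚ | IsAtom (AddSubmonoid.closure gramsSet) a} = gramsSet :=
    Set.Subset.antisymm (fun _ ha => ha.mem_of_closure) (fun _ ha => isAtom_of_mem_gramsSet ha)
  refine ⟨fun x hx => ?_, h⟩
  rwa [h]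

end PuiseuxSum
end

section
/- For each n ∈ ℕ, let p_n denote the n-th prime number that is at least 5, and let M_A be the Puiseux monoid generated by A := {(p_n − 1)/p_n : n ∈ ℕ}. Then the set of atoms of M_A is exactly A, and M_A is a finite factorization monoid (FFM). -/
namespace PuiseuxSum

/-- The set `A = {(p - 1)/p : p prime, p ≥ 5}`
(equivalently `{(pₙ - 1)/pₙ : n ∈ ℕ}` where `pₙ` is the `n`-th prime
that is at least `5`). -/
def setA : Set ℚ :=
  {q : ℚ | ∃ p : ℕ, Nat.Prime p ∧ 5 ≤ p ∧ q = ((p : ℚ) - 1) / p}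

theorem four_fifths_le_of_mem_setA {a : ℚ} (ha : a ∈ setA) : 4 / 5 ≤ a := by
  obtain ⟨p, -, hp5, rfl⟩ := ha
  have hp : (5 : ℚ) ≤ p := by exact_mod_cast hp5
  rw [le_div_iff₀ (by linarith)]
  linarith

theorem lt_one_of_mem_setA {a : ℚ} (ha : a ∈ setA) : a < 1 := by
  obtain ⟨p, -, hp5, rfl⟩ := ha
  have hp : (5 : ℚ) ≤ p := by exact_mod_cast hp5
  rw [div_lt_one (by linarith)]
  linarith

theorem card_mul_le_sum {s : Multiset ℚ} (hs : ∀ a ∈ s, a ∈ setA) :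
    (Multiset.card s : ℚ) * (4 / 5) ≤ s.sum := by
  simpa using Multiset.card_nsmul_le_sum (s := s) (a := (4 / 5 : ℚ))
    fun a ha => four_fifths_le_of_mem_setA (hs a ha)

theorem eq_zero_or_four_fifths_le {a : ℚ} (ha : a ∈ AddSubmonoid.closure setA) :
    a = 0 ∨ 4 / 5 ≤ a := by
  obtain ⟨s, hs, rfl⟩ := AddSubmonoid.exists_multiset_of_mem_closure ha
  rcases Multiset.empty_or_exists_mem s with rfl | ⟨b, hb⟩
  · simp
  · right
    have hcard : (1 : ℚ) ≤ Multiset.card s := by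
      exact_mod_cast Multiset.card_pos_iff_exists_mem.2 ⟨b, hb⟩
    linarith [card_mul_le_sum hs]

theorem isAtom_closure_setA_iff {a : ℚ} :
    IsAtom (AddSubmonoid.closure setA) a ↔ a ∈ setA := by
  constructor
  · rintro ⟨hmem, hne, hatom⟩
    obtain ⟨s, hs, rfl⟩ := AddSubmonoid.exists_multiset_of_mem_closure hmem
    rcases Multiset.empty_or_exists_mem s with rfl | ⟨b, hb⟩
    · simp at hne
    · obtain ⟨t, rfl⟩ := Multiset.exists_cons_of_mem hb
      have hbA := hs b hb
      have ht : t.sum ∈ AddSubmonoid.closure setA :=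
        AddSubmonoid.multiset_sum_mem _ _ fun c hc =>
          AddSubmonoid.subset_closure (hs c (Multiset.mem_cons_of_mem hc))
      rcases hatom b (AddSubmonoid.subset_closure hbA) t.sum ht (Multiset.sum_cons b t)
        with h | h
      · linarith [four_fifths_le_of_mem_setA hbA]
      · rwa [Multiset.sum_cons, h, add_zero]
  · intro ha
    refine ⟨AddSubmonoid.subset_closure ha, ?_, fun b hb c hc habc => ?_⟩
    · linarith [four_fifths_le_of_mem_setA ha]
    · rcases eq_zero_or_four_fifths_le hb with h | hb
      · exact Or.inl h
      rcases eq_zero_or_four_fifths_le hc with h | hc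
      · exact Or.inr h
      linarith [lt_one_of_mem_setA ha]

theorem padicNorm_add_le_one {p : ℕ} [Fact p.Prime] {x y : ℚ}
    (hx : padicNorm p x ≤ 1) (hy : padicNorm p y ≤ 1) : padicNorm p (x + y) ≤ 1 :=
  padicNorm.nonarchimedean.trans (max_le hx hy)

theorem padicNorm_sub_le_one {p : ℕ} [Fact p.Prime] {x y : ℚ}
    (hx : padicNorm p x ≤ 1) (hy : padicNorm p y ≤ 1) : padicNorm p (x - y) ≤ 1 :=
  padicNorm.sub.trans (max_le hx hy)

/-- Adding `1 / p` for each occurrence of `(p - 1) / p` in a multiset of elements of `setA`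
turns its sum into a `p`-integral rational. -/
theorem padicNorm_sum_add_count_div_le_one {p : ℕ} [Fact p.Prime] {s : Multiset ℚ}
    (hs : ∀ a ∈ s, a ∈ setA) :
    padicNorm p (s.sum + (s.count (((p : ℚ) - 1) / p) : ℚ) / p) ≤ 1 := by
  have hp0 : (p : ℚ) ≠ 0 := by exact_mod_cast (Fact.out : p.Prime).ne_zero
  induction s using Multiset.induction with
  | empty => simp
  | cons a s ih =>
    have ih := ih fun b hb => hs b (Multiset.mem_cons_of_mem hb)
    obtain ⟨r, hr, -, rfl⟩ := hs a (Multiset.mem_cons_self a s)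
    have hr0 : (r : ℚ) ≠ 0 := by exact_mod_cast hr.ne_zero
    by_cases hpr : p = r
    · subst hpr
      rw [Multiset.sum_cons, Multiset.count_cons_self]
      convert padicNorm_add_le_one ih padicNorm.one.le using 2
      push_cast
      field_simp
      ring
    · have hne : ((p : ℚ) - 1) / p ≠ ((r : ℚ) - 1) / r := by
        intro h
        rw [div_eq_div_iff hp0 hr0] at h
        exact hpr (by exact_mod_cast (by linarith : (p : ℚ) = r))
      have : Fact r.Prime := ⟨hr⟩
      have hnorm : padicNorm p (((r : ℚ) - 1) / r) ≤ 1 := by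
        rw [padicNorm.div, padicNorm.padicNorm_of_prime_of_ne hpr, div_one]
        exact_mod_cast padicNorm.of_int (p := p) ((r : ℤ) - 1)
      rw [Multiset.sum_cons, Multiset.count_cons_of_ne hne, add_assoc]
      exact padicNorm_add_le_one hnorm ih

theorem padicNorm_le_one_of_den_lt {p : ℕ} [Fact p.Prime] {q : ℚ} (h : q.den < p) :
    padicNorm p q ≤ 1 := by
  have hden : padicNorm p (q.den : ℚ) = 1 :=
    (padicNorm.nat_eq_one_iff q.den).2 fun hdvd =>
      (Nat.le_of_dvd q.den_pos hdvd).not_gt h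
  rw [← Rat.num_div_den q, padicNorm.div, hden, div_one]
  exact padicNorm.of_int q.num

theorem dvd_count_of_den_sum_lt {p : ℕ} [Fact p.Prime] {s : Multiset ℚ}
    (hs : ∀ a ∈ s, a ∈ setA) (h : s.sum.den < p) :
    p ∣ s.count (((p : ℚ) - 1) / p) := by
  set c := s.count (((p : ℚ) - 1) / p) with hc
  have hp : (0 : ℚ) < p := by exact_mod_cast (Fact.out : p.Prime).pos
  have hnorm : padicNorm p ((c : ℚ) / p) ≤ 1 := by
    simpa using padicNorm_sub_le_one (padicNorm_sum_add_count_div_le_one (p := p) hs)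
      (padicNorm_le_one_of_den_lt h)
  rw [padicNorm.div, padicNorm.padicNorm_p_of_prime, div_le_one (by positivity)] at hnorm
  have hdvd := (padicNorm.dvd_iff_norm_le (p := p) (n := 1) (z := (c : ℤ))).2
    (by simpa using hnorm)
  exact_mod_cast (by simpa using hdvd : (p : ℤ) ∣ (c : ℤ))

theorem le_max_of_mem_of_prime {p : ℕ} (hp : p.Prime) {s : Multiset ℚ}
    (hs : ∀ a ∈ s, a ∈ setA) (hmem : ((p : ℚ) - 1) / p ∈ s) :
    p ≤ max s.sum.den (Multiset.card s) := by
  have : Fact p.Prime := ⟨hp⟩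
  rcases le_or_gt p s.sum.den with h | h
  · exact le_max_of_le_left h
  · exact le_max_of_le_right <|
      (Nat.le_of_dvd (Multiset.count_pos.2 hmem) (dvd_count_of_den_sum_lt hs h)).trans
        (Multiset.count_le_card _ _)

theorem finite_setOf_multiset_card_le {α : Type*} (F : Finset α) (N : ℕ) :
    {s : Multiset α | (∀ a ∈ s, a ∈ F) ∧ Multiset.card s ≤ N}.Finite := by
  classical
  refine (N • F.val).powerset.toFinset.finite_toSet.subset fun s hs => ?_
  simp only [Finset.mem_coe, Multiset.mem_toFinset, Multiset.mem_powerset]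
  refine Multiset.le_iff_count.2 fun a => ?_
  by_cases ha : a ∈ s
  · rw [Multiset.count_nsmul, Multiset.count_eq_one_of_mem F.nodup (hs.1 a ha), mul_one]
    exact (Multiset.count_le_card a s).trans hs.2
  · simp [Multiset.count_eq_zero_of_notMem ha]

theorem finite_setOf_multiset_sum_eq (q : ℚ) :
    {s : Multiset ℚ | (∀ a ∈ s, a ∈ setA) ∧ s.sum = q}.Finite := by
  obtain ⟨N, hN⟩ := exists_nat_ge (q * (5 / 4))
  refine (finite_setOf_multiset_card_le
    ((Finset.range (max q.den N + 1)).image fun p : ℕ => ((p : ℚ) - 1) / p) N).subset ?_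
  rintro s ⟨hs, rfl⟩
  have hcard : Multiset.card s ≤ N := by
    have := card_mul_le_sum hs
    exact_mod_cast (by linarith : (Multiset.card s : ℚ) ≤ N)
  refine ⟨fun a ha => ?_, hcard⟩
  obtain ⟨p, hp, -, rfl⟩ := hs a ha
  exact Finset.mem_image.2 ⟨p, Finset.mem_range_succ_iff.2
    ((le_max_of_mem_of_prime hp hs ha).trans (max_le_max le_rfl hcard)), rfl⟩

/-- The set of atoms of `M_A := ⟨setA⟩` is exactly `setA`, and `M_A` is a
finite factorization monoid. -/
theorem atoms_MA_and_ffm :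
    {a : ℚ | IsAtom (AddSubmonoid.closure setA) a} = setA ∧
      FFM (AddSubmonoid.closure setA) := by
  have hatoms : {a : ℚ | IsAtom (AddSubmonoid.closure setA) a} = setA :=
    Set.ext fun _ => isAtom_closure_setA_iff
  refine ⟨hatoms, fun x hx => by rwa [hatoms], fun q _ => ?_⟩
  simpa only [IsFactorization, isAtom_closure_setA_iff] using finite_setOf_multiset_sum_eq q

end PuiseuxSum
end

section
/- For each n ∈ ℕ, let p_n denote the n-th prime number that is at least 5, and let M_B be the Puiseux monoid generated by {(p_n + 1)/p_n : n ∈ ℕ}. Then for every nonzero q ∈ M_B there exists N ∈ ℕ such that for all n ≥ N, the element (p_n + 1)/p_n does not divide q in M_B; in particular, every nonzero element of M_B is divisible by only finitely many atoms of M_B. -/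
namespace PuiseuxSum

/-- `c` divides `b` in `M` if `b = c + d` for some `d ∈ M`. -/
def DividesIn (M : AddSubmonoid ℚ) (c b : ℚ) : Prop :=
  ∃ d ∈ M, b = c + d

/-- `d` is a maximal common divisor of `x` and `y` in `M`: it is a common
divisor of `x` and `y` in `M` such that the only common divisor of `x - d` and
`y - d` in `M` is `0`. -/
def IsMCD (M : AddSubmonoid ℚ) (x y d : ℚ) : Prop :=
  d ∈ M ∧ DividesIn M d x ∧ DividesIn M d y ∧
    ∀ e ∈ M, DividesIn M e (x - d) → DividesIn M e (y - d) → e = 0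

/-- `M` is strongly atomic if it is atomic and every pair of elements of `M`
has a maximal common divisor in `M`. -/
def StronglyAtomic (M : AddSubmonoid ℚ) : Prop :=
  Atomic M ∧ ∀ x ∈ M, ∀ y ∈ M, ∃ d, IsMCD M x y d
/-- The set `B = {(p + 1)/p : p prime, p ≥ 5}`. -/
def setB : Set ℚ :=
  {q : ℚ | ∃ p : ℕ, Nat.Prime p ∧ 5 ≤ p ∧ q = ((p : ℚ) + 1) / p}

/-- Every element of `M_B` is a multiple of `(p + 1)/p` plus a nonnegative fraction whose
denominator is prime to `p`. -/
theorem exists_eq_mul_add_of_mem_closure_setB {p : ℕ} (hp : p.Prime) {x : ℚ}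
    (hx : x ∈ AddSubmonoid.closure setB) :
    ∃ c k m : ℕ, ¬ p ∣ m ∧ x = c * (((p : ℚ) + 1) / p) + k / m := by
  induction hx using AddSubmonoid.closure_induction with
  | mem x hx =>
    obtain ⟨r, hr, -, rfl⟩ := hx
    by_cases h : p = r
    · subst h
      exact ⟨1, 0, 1, hp.not_dvd_one, by simp⟩
    · exact ⟨0, r + 1, r, fun hd => h ((Nat.prime_dvd_prime_iff_eq hp hr).1 hd), by simp⟩
  | zero => exact ⟨0, 0, 1, hp.not_dvd_one, by simp⟩
  | add x y hx hy ihx ihy =>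
    obtain ⟨c, k, m, hm, rfl⟩ := ihx
    obtain ⟨c', k', m', hm', rfl⟩ := ihy
    have hm0 : (m : ℚ) ≠ 0 := by
      rintro h
      exact hm (by simp [Nat.cast_eq_zero.1 h])
    have hm0' : (m' : ℚ) ≠ 0 := by
      rintro h
      exact hm' (by simp [Nat.cast_eq_zero.1 h])
    refine ⟨c + c', k * m' + m * k', m * m', hp.not_dvd_mul hm hm', ?_⟩
    push_cast
    rw [← div_add_div _ _ hm0 hm0']
    ring

/-- If `(p + 1)/p` divides `q` in `M_B` and `p` does not divide the denominator of `q`,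
then `p + 1 ≤ q`. -/
theorem add_one_le_of_dividesIn {p : ℕ} (hp : p.Prime) {q : ℚ} (hpq : ¬ p ∣ q.den)
    (h : DividesIn (AddSubmonoid.closure setB) (((p : ℚ) + 1) / p) q) : (p : ℚ) + 1 ≤ q := by
  obtain ⟨d, hd, hq⟩ := h
  obtain ⟨c, k, m, hm, rfl⟩ := exists_eq_mul_add_of_mem_closure_setB hp hd
  have hp0 : (0 : ℚ) < p := by exact_mod_cast hp.pos
  have hm0 : (m : ℚ) ≠ 0 := by
    rintro h
    exact hm (by simp [Nat.cast_eq_zero.1 h])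
  have hden : (q.den : ℚ) ≠ 0 := by exact_mod_cast q.den_nz
  have key : ((q.den * m * (c + 1) * (p + 1) : ℕ) : ℤ) = p * (q.num * m - k * q.den) := by
    have h1 : (q.num : ℚ) / q.den = (p + 1) / p + (c * ((p + 1) / p) + k / m) := by
      rw [Rat.num_div_den]
      exact hq
    field_simp at h1
    have h2 : ((q.den * m * (c + 1) * (p + 1) : ℕ) : ℚ) = p * (q.num * m - k * q.den) := by
      push_cast
      linear_combination -h1
    exact_mod_cast h2
  have hdvd : p ∣ q.den * m * (c + 1) * (p + 1) := Int.natCast_dvd_natCast.1 ⟨_, key⟩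
  have hp1 : ¬ p ∣ p + 1 := fun h => hp.not_dvd_one ((Nat.dvd_add_right dvd_rfl).1 h)
  have hc : p ∣ c + 1 := by
    by_contra hc
    exact hp.not_dvd_mul (hp.not_dvd_mul (hp.not_dvd_mul hpq hm) hc) hp1 hdvd
  have hle : (p : ℚ) ≤ c + 1 := by exact_mod_cast Nat.le_of_dvd c.succ_pos hc
  have hk : (0 : ℚ) ≤ k / m := by positivity
  calc (p : ℚ) + 1 = p * ((p + 1) / p) := by field_simp
    _ ≤ (c + 1) * ((p + 1) / p) := by gcongr
    _ ≤ (p + 1) / p + (c * ((p + 1) / p) + k / m) := by linarith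
    _ = q := hq.symm

/-- In `M_B := ⟨setB⟩`: for every nonzero `q ∈ M_B` there is a bound `N` such
that `(p + 1)/p` does not divide `q` in `M_B` for any prime `p ≥ 5` beyond the
bound; in particular, every nonzero element of `M_B` is divisible by only
finitely many atoms of `M_B`. -/
theorem MB_divisible_by_finitely_many_atoms
    (q : ℚ) (hq : q ∈ AddSubmonoid.closure setB) (hq0 : q ≠ 0) :
    (∃ N : ℕ, ∀ p : ℕ, Nat.Prime p → 5 ≤ p → N ≤ p →
        ¬ DividesIn (AddSubmonoid.closure setB) (((p : ℚ) + 1) / p) q) ∧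
      {a : ℚ | IsAtom (AddSubmonoid.closure setB) a ∧
          DividesIn (AddSubmonoid.closure setB) a q}.Finite := by
  have hN : ∃ N : ℕ, ∀ p : ℕ, Nat.Prime p → 5 ≤ p → N ≤ p →
      ¬ DividesIn (AddSubmonoid.closure setB) (((p : ℚ) + 1) / p) q := by
    refine ⟨max (q.den + 1) ⌈q⌉₊, fun p hp _ hle hdiv => ?_⟩
    obtain ⟨hden, hceil⟩ := max_le_iff.1 hle
    have hlt := add_one_le_of_dividesIn hp (Nat.not_dvd_of_pos_of_lt q.den_pos hden) hdiv
    have := Nat.ceil_le.1 hceil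
    linarith
  refine ⟨hN, ?_⟩
  obtain ⟨N, hN⟩ := hN
  refine ((Set.finite_Iio N).image fun p : ℕ => ((p : ℚ) + 1) / p).subset ?_
  rintro a ⟨ha, hdiv⟩
  obtain ⟨p, hp, hp5, rfl⟩ := ha.mem_of_closure
  exact ⟨p, lt_of_not_ge fun hle => hN p hp hp5 hle hdiv, rfl⟩

end PuiseuxSum
end

section
/- For each n ∈ ℕ, let p_n denote the n-th prime number that is at least 5, and let M be the Puiseux monoid generated by {(p_n − 1)/p_n : n ∈ ℕ} ∪ {(p_n + 1)/p_n : n ∈ ℕ}. Then the set of atoms of M is exactly {(p_n − 1)/p_n : n ∈ ℕ} ∪ {(p_n + 1)/p_n : n ∈ ℕ}, M is a bounded factorization monoid (BFM), and the element 2 ∈ M has infinitely many factorizations of length 2; in particular, M is neither an FFM nor an LFFM. -/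
namespace PuiseuxSum

/-- The set `A ∪ B = {(p - 1)/p : p prime, p ≥ 5} ∪ {(p + 1)/p : p prime, p ≥ 5}`. -/
def setAB : Set ℚ :=
  {q : ℚ | ∃ p : ℕ, Nat.Prime p ∧ 5 ≤ p ∧ (q = ((p : ℚ) - 1) / p ∨ q = ((p : ℚ) + 1) / p)}

theorem mem_setAB_bounds {q : ℚ} (hq : q ∈ setAB) : 4 / 5 ≤ q ∧ q ≤ 6 / 5 := by
  obtain ⟨p, -, hp, rfl | rfl⟩ := hq
  all_goals
    have hp' : (5 : ℚ) ≤ p := by exact_mod_cast hp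
    have hpos : (0 : ℚ) < p := by linarith
    rw [le_div_iff₀ hpos, div_le_iff₀ hpos]
    constructor <;> linarith

theorem eq_zero_or_le_of_mem_closure {x : ℚ} (hx : x ∈ AddSubmonoid.closure setAB) :
    x = 0 ∨ 4 / 5 ≤ x := by
  induction hx using AddSubmonoid.closure_induction with
  | mem x hx => exact Or.inr (mem_setAB_bounds hx).1
  | zero => exact Or.inl rfl
  | add x y _ _ hx hy => grind

theorem isAtom_of_mem_setAB {a : ℚ} (ha : a ∈ setAB) :
    IsAtom (AddSubmonoid.closure setAB) a := by
  have hbounds := mem_setAB_bounds ha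
  refine ⟨AddSubmonoid.subset_closure ha, by linarith, fun b hb c hc h => ?_⟩
  have hb' := eq_zero_or_le_of_mem_closure hb
  have hc' := eq_zero_or_le_of_mem_closure hc
  grind

theorem setOf_isAtom_closure_setAB :
    {a : ℚ | IsAtom (AddSubmonoid.closure setAB) a} = setAB :=
  Set.ext fun _ => ⟨IsAtom.mem_of_closure, isAtom_of_mem_setAB⟩

theorem bfm_closure_setAB : BFM (AddSubmonoid.closure setAB) := by
  refine ⟨fun x hx => by rwa [setOf_isAtom_closure_setAB], fun q _ => ?_⟩
  refine (Set.finite_Iic ⌊q / (4 / 5)⌋₊).subset ?_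
  rintro _ ⟨s, ⟨hatoms, rfl⟩, rfl⟩
  have hsum : Multiset.card s • (4 / 5 : ℚ) ≤ s.sum :=
    Multiset.card_nsmul_le_sum fun a ha => (mem_setAB_bounds (hatoms a ha).mem_of_closure).1
  rw [nsmul_eq_mul] at hsum
  exact Nat.le_floor ((le_div_iff₀ (by norm_num)).2 hsum)

theorem infinite_factorizations_two :
    {s : Multiset ℚ |
      IsFactorization (AddSubmonoid.closure setAB) 2 s ∧ Multiset.card s = 2}.Infinite := by
  have hprimes : {p : ℕ | p.Prime ∧ 5 ≤ p}.Infinite :=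
    Set.infinite_of_forall_exists_gt fun n => by
      obtain ⟨p, hle, hp⟩ := Nat.exists_infinite_primes (n + 5)
      exact ⟨p, ⟨hp, by omega⟩, by omega⟩
  refine Set.infinite_of_injOn_mapsTo
    (f := fun p : ℕ => ({((p : ℚ) - 1) / p, ((p : ℚ) + 1) / p} : Multiset ℚ)) ?_ ?_ hprimes
  · rintro p ⟨-, hp⟩ r ⟨-, hr⟩ h
    have hp' : (0 : ℚ) < p := by exact_mod_cast (by omega : 0 < p)
    have hr' : (0 : ℚ) < r := by exact_mod_cast (by omega : 0 < r)
    have hmem : ((p : ℚ) - 1) / p ∈ ({((r : ℚ) - 1) / r, ((r : ℚ) + 1) / r} : Multiset ℚ) := by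
      beta_reduce at h
      rw [← h]
      simp
    simp only [Multiset.insert_eq_cons, Multiset.mem_cons, Multiset.mem_singleton] at hmem
    rcases hmem with hmem | hmem <;> rw [div_eq_div_iff hp'.ne' hr'.ne'] at hmem
    · exact_mod_cast (by linarith : (p : ℚ) = r)
    · linarith
  · rintro p ⟨hprime, hp⟩
    have hp' : (p : ℚ) ≠ 0 := by exact_mod_cast (by omega : p ≠ 0)
    refine ⟨⟨fun a ha => isAtom_of_mem_setAB ?_, ?_⟩, by simp⟩
    · simp only [Multiset.insert_eq_cons, Multiset.mem_cons, Multiset.mem_singleton] at ha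
      exact ⟨p, hprime, hp, ha⟩
    · simp only [Multiset.insert_eq_cons, Multiset.sum_cons, Multiset.sum_singleton]
      field_simp
      ring

theorem two_mem_closure_setAB : (2 : ℚ) ∈ AddSubmonoid.closure setAB := by
  obtain ⟨s, ⟨hatoms, hsum⟩, -⟩ := infinite_factorizations_two.nonempty
  exact hsum ▸ AddSubmonoid.multiset_sum_mem _ s fun a ha => (hatoms a ha).1

/-- For `M := ⟨setAB⟩`: the set of atoms of `M` is exactly `setAB`, `M` is a
BFM, the element `2` has infinitely many factorizations of length `2` in `M`,
and `M` is neither an FFM nor an LFFM. -/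
theorem M_AB_bfm_not_ffm :
    {a : ℚ | IsAtom (AddSubmonoid.closure setAB) a} = setAB ∧
      BFM (AddSubmonoid.closure setAB) ∧
      {s : Multiset ℚ |
        IsFactorization (AddSubmonoid.closure setAB) 2 s ∧ Multiset.card s = 2}.Infinite ∧
      ¬ FFM (AddSubmonoid.closure setAB) ∧
      ¬ LFFM (AddSubmonoid.closure setAB) := by
  exact ⟨setOf_isAtom_closure_setAB, bfm_closure_setAB, infinite_factorizations_two,
    fun h => infinite_factorizations_two ((h.2 2 two_mem_closure_setAB).subset fun _ hs => hs.1),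
    fun h => infinite_factorizations_two (h.2 2 two_mem_closure_setAB 2)⟩

end PuiseuxSum
end

section
/- For each n ∈ ℕ, let p_n denote the n-th prime number, and let M₂ be the Puiseux monoid generated by C := {(p_n + 1)/p_n² : n ∈ ℕ}. Then the set of atoms of M₂ is exactly C, and M₂ is a finite factorization monoid (FFM). -/
namespace PuiseuxSum

/-- The set `C = {(p + 1)/p² : p prime}`
(equivalently `{(pₙ + 1)/pₙ² : n ∈ ℕ}` where `pₙ` is the `n`-th prime). -/
def setC : Set ℚ :=
  {q : ℚ | ∃ p : ℕ, Nat.Prime p ∧ q = ((p : ℚ) + 1) / (p : ℚ) ^ 2}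

/-- The generator `(p + 1)/p²`. -/
def gen (p : ℕ) : ℚ := ((p : ℚ) + 1) / (p : ℚ) ^ 2

lemma gen_pos {p : ℕ} (hp : p.Prime) : 0 < gen p := by
  have : (0 : ℚ) < p := by exact_mod_cast hp.pos
  unfold gen
  positivity

lemma gen_lt_one {p : ℕ} (hp : p.Prime) : gen p < 1 := by
  have h2 : (2 : ℚ) ≤ p := by exact_mod_cast hp.two_le
  unfold gen
  rw [div_lt_one (by positivity)]
  nlinarith

lemma inv_le_gen {p : ℕ} (hp : p.Prime) : 1 / (p : ℚ) ≤ gen p := by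
  have h0 : (0 : ℚ) < p := by exact_mod_cast hp.pos
  unfold gen
  rw [div_le_div_iff₀ h0 (by positivity)]
  nlinarith

lemma setC_pos {x : ℚ} (hx : x ∈ setC) : 0 < x := by
  obtain ⟨p, hp, rfl⟩ := hx
  exact gen_pos hp

lemma exists_multiset_of_mem_closure {x : ℚ} (hx : x ∈ AddSubmonoid.closure setC) :
    ∃ s : Multiset ℚ, (∀ a ∈ s, a ∈ setC) ∧ s.sum = x :=
  AddSubmonoid.exists_multiset_of_mem_closure hx

lemma sum_mem_closure {s : Multiset ℚ} (hs : ∀ a ∈ s, a ∈ setC) :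
    s.sum ∈ AddSubmonoid.closure setC :=
  AddSubmonoid.multiset_sum_mem _ _ fun a ha => AddSubmonoid.subset_closure (hs a ha)

lemma sum_nonneg_of_setC {s : Multiset ℚ} (hs : ∀ a ∈ s, a ∈ setC) : 0 ≤ s.sum :=
  Multiset.sum_nonneg fun a ha => (setC_pos (hs a ha)).le

/-- The generators attached to the primes other than `r` are `r`-integral. -/
lemma padicNorm_gen_le_one {p r : ℕ} (hp : p.Prime) (hr : r.Prime) (hne : p ≠ r) :
    padicNorm r (gen p) ≤ 1 := by
  have := Fact.mk hr
  have := Fact.mk hp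
  have h1 : padicNorm r ((p : ℚ) ^ 2) = 1 := by
    have : padicNorm r (p : ℚ) = 1 := padicNorm.padicNorm_of_prime_of_ne hne.symm
    rw [pow_two, padicNorm.mul, this, one_mul]
  unfold gen
  rw [padicNorm.div, h1, div_one]
  exact_mod_cast padicNorm.of_nat (p := r) (p + 1)

lemma padicNorm_sum_le_one {r : ℕ} (hr : r.Prime) (s : Multiset ℚ)
    (hs : ∀ a ∈ s, padicNorm r a ≤ 1) : padicNorm r s.sum ≤ 1 := by
  have := Fact.mk hr
  induction s using Multiset.induction_on with
  | empty => simp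
  | cons a t ih =>
    rw [Multiset.sum_cons]
    exact padicNorm.nonarchimedean.trans
      (max_le (hs a (by simp)) (ih fun b hb => hs b (by simp [hb])))

/-- If `(r + 1)/r²` occurs in a factorization of an `r`-integral number `q`, then its
multiplicity is divisible by `r²`, which forces `r < q`. -/
lemma lt_sum_of_gen_mem {r : ℕ} (hr : r.Prime) {s : Multiset ℚ} (hs : ∀ a ∈ s, a ∈ setC)
    (hmem : gen r ∈ s) (hq : padicNorm r s.sum ≤ 1) : (r : ℚ) < s.sum := by
  have := Fact.mk hr
  have hr0 : (0 : ℚ) < r := by exact_mod_cast hr.pos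
  set n := s.count (gen r) with hn
  have hn0 : 0 < n := Multiset.count_pos.2 hmem
  set t := s.filter fun a => a ≠ gen r with ht
  have hsum : s.sum = n * gen r + t.sum := by
    rw [← Multiset.filter_add_not (fun a => a = gen r) s, Multiset.sum_add,
      Multiset.filter_eq', Multiset.sum_replicate, nsmul_eq_mul]
  have ht_mem : ∀ a ∈ t, a ∈ setC := fun a ha => hs a (Multiset.mem_of_mem_filter ha)
  have ht1 : padicNorm r t.sum ≤ 1 := by
    refine padicNorm_sum_le_one hr t fun a ha => ?_
    obtain ⟨p, hp, rfl⟩ := ht_mem a ha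
    refine padicNorm_gen_le_one hp hr ?_
    rintro rfl
    exact (Multiset.mem_filter.1 ha).2 rfl
  have h1 : padicNorm r (n * gen r) ≤ 1 := by
    rw [show (n : ℚ) * gen r = s.sum - t.sum by rw [hsum]; ring]
    exact padicNorm.sub.trans (max_le hq ht1)
  have hdvd : r ^ 2 ∣ n * (r + 1) := by
    have h2 : padicNorm r (((n * (r + 1) : ℕ) : ℤ) : ℚ) ≤ (r : ℚ) ^ (-(2 : ℕ) : ℤ) := by
      have : (((n * (r + 1) : ℕ) : ℤ) : ℚ) = n * gen r * ((r : ℚ) * r) := by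
        unfold gen
        push_cast
        field_simp
      rw [this, padicNorm.mul, padicNorm.mul r, padicNorm.padicNorm_p_of_prime]
      calc _ ≤ 1 * ((r : ℚ)⁻¹ * (r : ℚ)⁻¹) := by gcongr
        _ = _ := by rw [zpow_neg, zpow_natCast]; field_simp
    have h3 := padicNorm.dvd_iff_norm_le.2 h2
    exact_mod_cast h3
  have hle : r ^ 2 ≤ n :=
    Nat.le_of_dvd hn0 ((Nat.Coprime.pow_left 2 (by simp)).dvd_of_dvd_mul_right hdvd)
  have hleq : (r : ℚ) ^ 2 ≤ n := by exact_mod_cast hle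
  have h4 : (r : ℚ) ^ 2 * gen r = r + 1 := by
    unfold gen
    field_simp
  have h5 := mul_le_mul_of_nonneg_right hleq (gen_pos hr).le
  have h6 := sum_nonneg_of_setC ht_mem
  linarith

lemma eq_singleton_of_sum_eq_gen {p : ℕ} (hp : p.Prime) {s : Multiset ℚ}
    (hs : ∀ a ∈ s, a ∈ setC) (h : s.sum = gen p) : s = {gen p} := by
  have hall : ∀ a ∈ s, a = gen p := by
    intro a ha
    obtain ⟨r, hr, rfl⟩ := hs a ha
    by_contra hne
    have hpr : p ≠ r := by
      rintro rfl
      exact hne rfl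
    have h1 := lt_sum_of_gen_mem hr hs ha (h ▸ padicNorm_gen_le_one hp hr hpr)
    have h2 := gen_lt_one hp
    have h3 : (1 : ℚ) ≤ r := by exact_mod_cast hr.one_le
    linarith
  have hrep := Multiset.eq_replicate_card.2 hall
  rw [hrep, Multiset.sum_replicate, nsmul_eq_mul] at h
  have h1 : (Multiset.card s : ℚ) = 1 := mul_right_cancel₀ (gen_pos hp).ne' (by rw [h, one_mul])
  have h2 : Multiset.card s = 1 := by exact_mod_cast h1
  rw [hrep, h2, Multiset.replicate_one]

lemma setOf_isAtom : {a : ℚ | IsAtom (AddSubmonoid.closure setC) a} = setC := by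
  ext a
  constructor
  · rintro ⟨ha, ha0, hatom⟩
    obtain ⟨s, hs, rfl⟩ := exists_multiset_of_mem_closure ha
    induction s using Multiset.induction_on with
    | empty => simp at ha0
    | cons x t =>
      have hx : x ∈ setC := hs x (by simp)
      have ht : ∀ b ∈ t, b ∈ setC := fun b hb => hs b (by simp [hb])
      rcases hatom x (AddSubmonoid.subset_closure hx) t.sum (sum_mem_closure ht)
        (Multiset.sum_cons x t) with h | h
      · exact absurd h (setC_pos hx).ne'
      · simpa [h] using hx
  · intro ha
    refine ⟨AddSubmonoid.subset_closure ha, (setC_pos ha).ne', ?_⟩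
    intro b hb c hc habc
    obtain ⟨s, hs, rfl⟩ := exists_multiset_of_mem_closure hb
    obtain ⟨t, ht, rfl⟩ := exists_multiset_of_mem_closure hc
    obtain ⟨p, hp, rfl⟩ := ha
    have h := eq_singleton_of_sum_eq_gen hp (s := s + t)
      (fun a ha => (Multiset.mem_add.1 ha).elim (hs a) (ht a))
      (by rw [Multiset.sum_add]; exact habc.symm)
    have hcard := congrArg Multiset.card h
    rw [Multiset.card_add, Multiset.card_singleton] at hcard
    rcases Nat.eq_zero_or_pos (Multiset.card s) with h0 | h0
    · left
      simp [Multiset.card_eq_zero.1 h0]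
    · right
      simp [Multiset.card_eq_zero.1 (show Multiset.card t = 0 by omega)]

lemma finite_setOf_sum_eq (q : ℚ) :
    {s : Multiset ℚ | (∀ a ∈ s, a ∈ setC) ∧ s.sum = q}.Finite := by
  set N := max ⌈q⌉₊ q.den with hN
  set K := ⌈q * N⌉₊ with hK
  refine (Set.finite_Iic (K • ((Finset.range (N + 1)).image gen).val)).subset ?_
  rintro s ⟨hs, rfl⟩
  rw [Set.mem_Iic, Multiset.le_iff_count]
  intro a
  by_cases ha : a ∈ s
  swap
  · simp [Multiset.count_eq_zero_of_notMem ha]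
  obtain ⟨r, hr, hra⟩ := hs a ha
  change a = gen r at hra
  subst hra
  have := Fact.mk hr
  have hrN : r ≤ N := by
    by_cases hd : r ∣ s.sum.den
    · exact (Nat.le_of_dvd s.sum.den_pos hd).trans (le_max_right _ _)
    · have h1 := lt_sum_of_gen_mem hr hs ha (by
        have hden : padicNorm r (s.sum.den : ℚ) = 1 := (padicNorm.nat_eq_one_iff _).2 hd
        rw [← Rat.num_div_den s.sum, padicNorm.div, hden, div_one]
        exact padicNorm.of_int _)
      refine le_trans ?_ (le_max_left _ _)
      exact_mod_cast h1.le.trans (Nat.le_ceil _)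
  have hmem : gen r ∈ (Finset.range (N + 1)).image gen :=
    Finset.mem_image_of_mem _ (Finset.mem_range.2 (by omega))
  rw [Multiset.count_nsmul,
    Multiset.count_eq_one_of_mem (Finset.nodup _) hmem, mul_one]
  have hr0 : (0 : ℚ) < r := by exact_mod_cast hr.pos
  have hle : (s.count (gen r) : ℚ) * gen r ≤ s.sum := by
    rw [← nsmul_eq_mul, ← Multiset.sum_replicate]
    obtain ⟨t, ht⟩ := Multiset.le_iff_exists_add.1
      (Multiset.le_count_iff_replicate_le.1 (le_refl (s.count (gen r))))
    have h1 : 0 ≤ t.sum := sum_nonneg_of_setC fun a ha =>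
      hs a (by rw [ht]; exact Multiset.mem_add.2 (Or.inr ha))
    conv_rhs => rw [ht, Multiset.sum_add]
    linarith
  have h2 : (s.count (gen r) : ℚ) * (1 / r) ≤ s.sum :=
    (mul_le_mul_of_nonneg_left (inv_le_gen hr) (by positivity)).trans hle
  have h3 : (s.count (gen r) : ℚ) ≤ s.sum * r := by
    rwa [mul_one_div, div_le_iff₀ hr0] at h2
  have h4 : s.sum * (r : ℚ) ≤ s.sum * N :=
    mul_le_mul_of_nonneg_left (by exact_mod_cast hrN) (sum_nonneg_of_setC hs)
  exact_mod_cast (h3.trans h4).trans (Nat.le_ceil _)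

/-- The set of atoms of `M₂ := ⟨setC⟩` is exactly `setC`, and `M₂` is a finite
factorization monoid. -/
theorem atoms_M2_and_ffm :
    {a : ℚ | IsAtom (AddSubmonoid.closure setC) a} = setC ∧
      FFM (AddSubmonoid.closure setC) := by
  refine ⟨setOf_isAtom, fun x hx => by rwa [setOf_isAtom], fun q _ => ?_⟩
  refine (finite_setOf_sum_eq q).subset ?_
  rintro s ⟨hs, hq⟩
  exact ⟨fun a ha => setOf_isAtom.subset (hs a ha), hq⟩

end PuiseuxSum
end

section
/- Let M₁ := {0} ∪ {q ∈ ℚ : q ≥ 1}, an additive submonoid of ℚ≥0. Then the set of atoms of M₁ is exactly {q ∈ ℚ : 1 ≤ q < 2}, M₁ is a bounded factorization monoid (BFM), and the element 3 has infinitely many factorizations of length 2 in M₁; in particular, M₁ is not an FFM. -/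
namespace PuiseuxSum

/-- The Puiseux monoid `M₁ := {0} ∪ {q ∈ ℚ : q ≥ 1}`. -/
def M₁ : AddSubmonoid ℚ where
  carrier := {q : ℚ | q = 0 ∨ 1 ≤ q}
  zero_mem' := Or.inl rfl
  add_mem' := by
    rintro a b (rfl | ha) (rfl | hb)
    · exact Or.inl (by simp)
    · exact Or.inr (by simpa using hb)
    · exact Or.inr (by simpa using ha)
    · exact Or.inr (by linarith)

theorem mem_M₁ {q : ℚ} : q ∈ M₁ ↔ q = 0 ∨ 1 ≤ q := Iff.rfl

theorem isAtom_M₁_iff {a : ℚ} : IsAtom M₁ a ↔ 1 ≤ a ∧ a < 2 := by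
  constructor
  · rintro ⟨ha, ha0, h⟩
    have h1 : 1 ≤ a := (mem_M₁.1 ha).resolve_left ha0
    refine ⟨h1, ?_⟩
    by_contra! h2
    rcases h 1 (mem_M₁.2 (Or.inr le_rfl)) (a - 1) (mem_M₁.2 (Or.inr (by linarith)))
      (by ring) with h | h <;> linarith
  · rintro ⟨h1, h2⟩
    refine ⟨mem_M₁.2 (Or.inr h1), by linarith, fun b hb c hc h => ?_⟩
    rcases mem_M₁.1 hb with hb | hb
    · exact Or.inl hb
    rcases mem_M₁.1 hc with hc | hc
    · exact Or.inr hc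
    linarith

theorem atomic_M₁ : Atomic M₁ := by
  intro x hx
  rcases mem_M₁.1 hx with rfl | hx
  · exact zero_mem _
  have hn : 1 ≤ ⌊x⌋₊ := (Nat.one_le_floor_iff x).2 hx
  have hn' : (1 : ℚ) ≤ ⌊x⌋₊ := by exact_mod_cast hn
  have hle : (⌊x⌋₊ : ℚ) ≤ x := Nat.floor_le (by linarith)
  have hlt : x < ⌊x⌋₊ + 1 := Nat.lt_floor_add_one x
  have hpos : (0 : ℚ) < ⌊x⌋₊ := by linarith
  have hatom : x / ⌊x⌋₊ ∈ {a : ℚ | IsAtom M₁ a} :=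
    isAtom_M₁_iff.2 ⟨(one_le_div hpos).2 hle, (div_lt_iff₀ hpos).2 (by linarith)⟩
  have hmul : ⌊x⌋₊ • (x / ⌊x⌋₊) = x := by
    rw [nsmul_eq_mul, mul_div_cancel₀ _ hpos.ne']
  rw [← hmul]
  exact nsmul_mem (AddSubmonoid.subset_closure hatom) _

theorem IsFactorization.card_le {q : ℚ} {s : Multiset ℚ} (h : IsFactorization M₁ q s) :
    (Multiset.card s : ℚ) ≤ q := by
  have := Multiset.card_nsmul_le_sum (s := s) (a := 1) fun x hx => (isAtom_M₁_iff.1 (h.1 x hx)).1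
  simpa [h.2] using this

theorem bfm_M₁ : BFM M₁ := by
  refine ⟨atomic_M₁, fun q _ => (Set.finite_Iic ⌊q⌋₊).subset ?_⟩
  rintro _ ⟨s, hs, rfl⟩
  exact Nat.le_floor hs.card_le

theorem infinite_factorizations_three :
    {s : Multiset ℚ | IsFactorization M₁ 3 s ∧ Multiset.card s = 2}.Infinite := by
  have hinf : (Set.Ioo (1 : ℚ) (3 / 2)).Infinite := Set.Ioo_infinite (by norm_num)
  refine Set.infinite_of_injOn_mapsTo (f := fun a : ℚ => ({a, 3 - a} : Multiset ℚ)) ?_ ?_ hinf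
  · intro a ha b hb hab
    have hmem : a ∈ ({b, 3 - b} : Multiset ℚ) := by
      rw [← show ({a, 3 - a} : Multiset ℚ) = {b, 3 - b} from hab]
      simp
    rcases (by simpa using hmem : a = b ∨ a = 3 - b) with h | h
    · exact h
    · linarith [ha.2, hb.2]
  · rintro a ⟨h1, h2⟩
    refine ⟨⟨fun x hx => isAtom_M₁_iff.2 ?_, by simp⟩, by simp⟩
    rcases (by simpa using hx : x = a ∨ x = 3 - a) with rfl | rfl <;>
      constructor <;> linarith

/-- The set of atoms of `M₁ = {0} ∪ ℚ≥1` is exactly `{q : 1 ≤ q < 2}`, `M₁`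
is a BFM, the element `3` has infinitely many factorizations of length `2`,
and `M₁` is not an FFM. -/
theorem M₁_bfm_not_ffm :
    {a : ℚ | IsAtom M₁ a} = {q : ℚ | 1 ≤ q ∧ q < 2} ∧
      BFM M₁ ∧
      {s : Multiset ℚ | IsFactorization M₁ 3 s ∧ Multiset.card s = 2}.Infinite ∧
      ¬ FFM M₁ := by
  refine ⟨Set.ext fun a => isAtom_M₁_iff, bfm_M₁, infinite_factorizations_three, fun h => ?_⟩
  exact infinite_factorizations_three
    ((h.2 3 (mem_M₁.2 (Or.inr (by norm_num)))).subset fun s hs => hs.1)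

end PuiseuxSum
end
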